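/- For any countable class C of recoverable environments, there exists a single policy p which is upper self-optimizing for C, i.e., V̄(ν,p) = V̄*_ν with probability 1 for every environment ν ∈ C. -/

import Mathlib

open MeasureTheory Filter Finset Asymptotics
open scoped ENNReal Classical

noncomputable section

namespace RL

/-- A perception `x = (r, o)`: a reward `r ∈ R = {0, …, r_max}` together with an
observation `o ∈ O`. -/
abbrev Percept (O : Type) (rmax : ℕ) := Fin (rmax + 1) × O

/-- A cycle `z = (y, r, o)`: an action together with the resulting perception. -/
abbrev Cycle (Y O : Type) (rmax : ℕ) := Y × Percept O rmax

/-- A deterministic policy maps a history `z_{<k}` to the next action `y_k`. -/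
abbrev Policy (Y O : Type) (rmax : ℕ) := List (Cycle Y O rmax) → Y

/-- An infinite interaction sequence. -/
abbrev Traj (Y O : Type) (rmax : ℕ) := ℕ → Cycle Y O rmax

instance (Y O : Type) (rmax : ℕ) : MeasurableSpace (Cycle Y O rmax) := ⊤

/-- The reward of a cycle `z = (y, (r, o))`, as a real number. -/
def rew {Y O : Type} {rmax : ℕ} (z : Cycle Y O rmax) : ℝ := ((z.2.1 : ℕ) : ℝ)

/-- The cylinder set of all infinite sequences extending the finite sequence `l`. -/
def cylSet {A : Type} (l : List A) : Set (ℕ → A) := {ω | ∀ i : Fin l.length, ω i.1 = l.get i}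

/-- An environment: conditional probabilities `ν(x_k | z_{<k} y_k)` of the next perception
given the history, together with, for each (deterministic) policy `p`, the induced
probability measure on interaction sequences, which on cylinder sets is given by the
product of the conditional probabilities (actions being forced by the policy). -/
structure Environment (Y O : Type) [Fintype Y] [Fintype O] (rmax : ℕ) where
  cond : List (Cycle Y O rmax) → Y → Percept O rmax → ℝ
  cond_nonneg : ∀ h y x, 0 ≤ cond h y x
  cond_sum_one : ∀ h y, ∑ x : Percept O rmax, cond h y x = 1
  P : Policy Y O rmax → Measure (Traj Y O rmax)
  P_prob : ∀ p, IsProbabilityMeasure (P p)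
  P_cyl : ∀ (p : Policy Y O rmax) (h : List (Cycle Y O rmax)) (z : Cycle Y O rmax),
    P p (cylSet (h ++ [z]))
      = P p (cylSet h) * ENNReal.ofReal (if z.1 = p h then cond h z.1 z.2 else 0)

variable {Y O : Type} [Fintype Y] [Fintype O] {rmax : ℕ}

/-- The average reward `(1/m) r_{1..m}` of the first `m` steps of a trajectory. -/
def avg {Y O : Type} {rmax : ℕ} (ω : Traj Y O rmax) (m : ℕ) : ℝ :=
  (∑ i ∈ Finset.range m, rew (ω i)) / m

/-- `V(ν,p) = V` : the average limiting value exists a.s. and equals the constant `V`. -/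
def ValueIs (ν : Environment Y O rmax) (p : Policy Y O rmax) (V : ℝ) : Prop :=
  ν.P p {ω | Tendsto (avg ω) atTop (nhds V)} = 1

/-- `V̄(ν,p) = V` : the upper limiting average value is a.s. the constant `V`. -/
def UpperValueIs (ν : Environment Y O rmax) (p : Policy Y O rmax) (V : ℝ) : Prop :=
  ν.P p {ω | limsup (avg ω) atTop = V} = 1

/-- `V` is the optimal value `V*_ν` of `ν`: some policy `p_ν` achieves average value `V`
a.s., and every policy has upper average value `≤ V` a.s. -/
def IsOptimalValue (ν : Environment Y O rmax) (V : ℝ) : Prop :=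
  ∃ p, ValueIs ν p V ∧ ∀ q : Policy Y O rmax, ν.P q {ω | limsup (avg ω) atTop ≤ V} = 1

/-- An environment is explorable if it has an optimal value `V*_ν`. -/
def Explorable (ν : Environment Y O rmax) : Prop := ∃ V, IsOptimalValue ν V

/-- `V` is the upper optimal value `V̄*_ν` of `ν`. -/
def IsUpperOptimalValue (ν : Environment Y O rmax) (V : ℝ) : Prop :=
  ∃ p, UpperValueIs ν p V ∧ ∀ q : Policy Y O rmax, ν.P q {ω | limsup (avg ω) atTop ≤ V} = 1

/-- An environment is upper explorable if it has an upper optimal value `V̄*_ν`. -/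
def UpperExplorable (ν : Environment Y O rmax) : Prop := ∃ V, IsUpperOptimalValue ν V

/-- `ν(x_{<k} | y_{<k})` : the probability of the perceptions of the history `h`,
given its actions. -/
def histProbX (ν : Environment Y O rmax) (h : List (Cycle Y O rmax)) : ℝ :=
  ∏ i : Fin h.length, ν.cond (h.take i.1) (h.get i).1 (h.get i).2

/-- Replace the first `k-1` actions of the policy `p` by the actions `y_{<k}` of the
history `h`. -/
def replacePolicy (h : List (Cycle Y O rmax)) (p : Policy Y O rmax) : Policy Y O rmax :=
  fun l => if hl : l.length < h.length then (h.get ⟨l.length, hl⟩).1 else p l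

/-- The measure induced by `(p, ν)` conditional on the history `h = z_{<k}`:
`ν`-probabilities conditional on `x_{<k}`, with the first `k-1` actions of `p`
replaced by `y_{<k}`. -/
def condMeasure (ν : Environment Y O rmax) (p : Policy Y O rmax)
    (h : List (Cycle Y O rmax)) : Measure (Traj Y O rmax) :=
  ProbabilityTheory.cond (ν.P (replacePolicy h p)) (cylSet h)

/-- `P( · | z_{<k})` under policy `p` in environment `ν`. -/
def condProb (ν : Environment Y O rmax) (p : Policy Y O rmax)
    (h : List (Cycle Y O rmax)) (A : Set (Traj Y O rmax)) : ℝ≥0∞ :=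
  condMeasure ν p h A

/-- `V(ν,p,z_{<k}) = V` : conditional on `z_{<k}`, the average limiting value is a.s. `V`. -/
def CondValueIs (ν : Environment Y O rmax) (p : Policy Y O rmax)
    (h : List (Cycle Y O rmax)) (V : ℝ) : Prop :=
  condProb ν p h {ω | Tendsto (avg ω) atTop (nhds V)} = 1

/-- `V̄(ν,p,z_{<k}) = V` : conditional on `z_{<k}`, the upper limiting average value
is a.s. `V`. -/
def CondUpperValueIs (ν : Environment Y O rmax) (p : Policy Y O rmax)
    (h : List (Cycle Y O rmax)) (V : ℝ) : Prop :=
  condProb ν p h {ω | limsup (avg ω) atTop = V} = 1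

/-- `V` is the conditional optimal value `V*_ν(z_{<k})`. -/
def IsCondOptimalValue (ν : Environment Y O rmax) (h : List (Cycle Y O rmax)) (V : ℝ) : Prop :=
  ∃ p, CondValueIs ν p h V ∧
    ∀ q : Policy Y O rmax, condProb ν q h {ω | limsup (avg ω) atTop ≤ V} = 1

/-- `V` is the conditional upper optimal value `V̄*_ν(z_{<k})`. -/
def IsCondUpperOptimalValue (ν : Environment Y O rmax) (h : List (Cycle Y O rmax)) (V : ℝ) :
    Prop :=
  ∃ p, CondUpperValueIs ν p h V ∧
    ∀ q : Policy Y O rmax, condProb ν q h {ω | limsup (avg ω) atTop ≤ V} = 1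

/-- Strongly explorable: after any history of positive probability there is a conditionally
optimal value. -/
def StronglyExplorable (ν : Environment Y O rmax) : Prop :=
  ∀ h, 0 < histProbX ν h → ∃ V, IsCondOptimalValue ν h V

/-- Strongly upper explorable. -/
def StronglyUpperExplorable (ν : Environment Y O rmax) : Prop :=
  ∀ h, 0 < histProbX ν h → ∃ V, IsCondUpperOptimalValue ν h V

/-- The worst-case optimal value `W*_ν = inf_{z_{<k}} V*_ν(z_{<k})`. -/
def Wstar (ν : Environment Y O rmax) : ℝ :=
  sInf {V | ∃ h, 0 < histProbX ν h ∧ IsCondOptimalValue ν h V}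

/-- The worst-case upper optimal value `W̄*_ν = inf_{z_{<k}} V̄*_ν(z_{<k})`. -/
def WstarUpper (ν : Environment Y O rmax) : ℝ :=
  sInf {V | ∃ h, 0 < histProbX ν h ∧ IsCondUpperOptimalValue ν h V}

/-- Recoverable: after any history of positive probability, some policy attains the
upper optimal value `V̄*_ν` with conditional probability 1. -/
def Recoverable (ν : Environment Y O rmax) : Prop :=
  ∃ V, IsUpperOptimalValue ν V ∧
    ∀ h, 0 < histProbX ν h →
      ∃ p, condProb ν p h {ω | limsup (avg ω) atTop = V} = 1

/-- The quantitative part of value-stability, with target value `W`: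
rewards `r_i ∈ [0, r_max]` with `(1/n) r_{1..n} → W`, `d(k,ε) = o(k)`,
`Σ_n φ(n,ε) < ∞`, and from any history `z_{<k}` some policy `p` recovers:
`P( r_{k..k+n} − r^{pν}_{k..k+n} > d(k,ε) + nε | z_{<k} ) ≤ φ(n,ε)`. -/
def ValueStableCore (ν : Environment Y O rmax) (W : ℝ) (r : ℕ → ℝ)
    (d : ℕ → ℝ → ℝ) (φ : ℕ → ℝ → ℝ) : Prop :=
  (∀ i, r i ∈ Set.Icc (0 : ℝ) (rmax : ℝ)) ∧
  Tendsto (fun n => (∑ i ∈ Finset.range n, r i) / n) atTop (nhds W) ∧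
  (∀ ε : ℝ, 0 < ε → (fun k : ℕ => d k ε) =o[atTop] fun k : ℕ => (k : ℝ)) ∧
  (∀ ε : ℝ, 0 < ε → Summable fun n => φ n ε) ∧
  ∀ h : List (Cycle Y O rmax), ∃ p : Policy Y O rmax, ∀ ε : ℝ, 0 < ε → ∀ n : ℕ,
    condProb ν p h
      {ω | d h.length ε + n * ε <
        (∑ i ∈ Finset.Icc h.length (h.length + n), r i)
          - ∑ i ∈ Finset.Icc h.length (h.length + n), rew (ω i)}
      ≤ ENNReal.ofReal (φ n ε)

/-- Value-stability with explicit witnesses `V = V*_ν`, `r`, `d`, `φ`. -/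
def ValueStableWith (ν : Environment Y O rmax) (V : ℝ) (r : ℕ → ℝ)
    (d : ℕ → ℝ → ℝ) (φ : ℕ → ℝ → ℝ) : Prop :=
  IsOptimalValue ν V ∧ ValueStableCore ν V r d φ

/-- A value-stable environment. -/
def ValueStable (ν : Environment Y O rmax) : Prop :=
  ∃ V r d φ, ValueStableWith ν V r d φ

/-- A worst-case value-stable environment: strongly explorable, and the value-stability
condition holds with target `W*_ν`. -/
def WorstCaseValueStable (ν : Environment Y O rmax) : Prop :=
  StronglyExplorable ν ∧ ∃ r d φ, ValueStableCore ν (Wstar ν) r d φ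

/-- A policy is self-optimizing for a class `C` if it attains the optimal value `V*_ν`
in every `ν ∈ C`. -/
def SelfOptimizing (p : Policy Y O rmax) (C : Set (Environment Y O rmax)) : Prop :=
  ∀ ν ∈ C, ∀ V, IsOptimalValue ν V → ValueIs ν p V

/-- A policy is upper self-optimizing for a class `C` if it attains the upper optimal
value `V̄*_ν` in every `ν ∈ C`. -/
def UpperSelfOptimizing (p : Policy Y O rmax) (C : Set (Environment Y O rmax)) : Prop :=
  ∀ ν ∈ C, ∀ V, IsUpperOptimalValue ν V → UpperValueIs ν p V

/-- A deterministic environment: all conditional probabilities are `0` or `1`. -/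
def Deterministic (ν : Environment Y O rmax) : Prop :=
  ∀ h y x, ν.cond h y x = 0 ∨ ν.cond h y x = 1

/-- In a deterministic environment, the perception following history `h` and action `y`. -/
def pick [Nonempty O] (ν : Environment Y O rmax) (h : List (Cycle Y O rmax)) (y : Y) :
    Percept O rmax :=
  if hx : ∃ x, ν.cond h y x = 1 then hx.choose else Classical.arbitrary _

/-- The (deterministic) history generated by policy `p` in a deterministic environment. -/
def detHist [Nonempty O] (ν : Environment Y O rmax) (p : Policy Y O rmax) :
    ℕ → List (Cycle Y O rmax)
  | 0 => []
  | n + 1 =>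
      detHist ν p n ++ [(p (detHist ν p n), pick ν (detHist ν p n) (p (detHist ν p n)))]

/-- The cycle `z_n` generated by policy `p` in a deterministic environment. -/
def detZ [Nonempty O] (ν : Environment Y O rmax) (p : Policy Y O rmax) (n : ℕ) :
    Cycle Y O rmax :=
  (p (detHist ν p n), pick ν (detHist ν p n) (p (detHist ν p n)))

end RL

namespace RL

/-- The history formed by the first `n` cycles of a trajectory. -/
def trajPrefix {A : Type} (n : ℕ) (ω : ℕ → A) : List A := List.ofFn fun i : Fin n => ω i

theorem length_trajPrefix {A : Type} (n : ℕ) (ω : ℕ → A) : (trajPrefix n ω).length = n := by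
  simp [trajPrefix]

theorem mem_cylSet_iff {A : Type} (l : List A) (ω : ℕ → A) :
    ω ∈ cylSet l ↔ trajPrefix l.length ω = l := by
  constructor
  · intro h
    refine List.ext_getElem (by simp [trajPrefix]) fun i h₁ h₂ => ?_
    simpa [trajPrefix] using h ⟨i, h₂⟩
  · intro h i
    have := congrArg (fun l' : List A => l'[i.1]?) h
    simpa [trajPrefix] using this

theorem trajPrefix_preimage_singleton {A : Type} (l : List A) :
    trajPrefix l.length ⁻¹' {l} = cylSet l := by
  ext ω
  simp [mem_cylSet_iff]

theorem cylSet_anti {A : Type} {l l' : List A} (h : l <+: l') : cylSet l' ⊆ cylSet l := by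
  intro ω hω i
  have := hω ⟨i, i.2.trans_le h.length_le⟩
  simpa [h.getElem i.2] using this

theorem cylSet_nil {A : Type} : cylSet ([] : List A) = Set.univ := by
  ext ω
  simp [cylSet]

theorem isPrefix_trajPrefix {A : Type} {h : List A} {ω : ℕ → A} {N : ℕ} (hω : ω ∈ cylSet h)
    (hN : h.length ≤ N) : h <+: trajPrefix N ω := by
  rw [List.prefix_iff_eq_take]
  refine List.ext_getElem (by simp [trajPrefix, hN]) fun i h₁ h₂ => ?_
  simpa [trajPrefix] using (hω ⟨i, h₁⟩).symm

section Trajectories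

variable {Y O : Type} {rmax : ℕ}

instance : DiscreteMeasurableSpace (Cycle Y O rmax) := ⟨fun _ => trivial⟩

theorem measurableSet_cylSet (l : List (Cycle Y O rmax)) : MeasurableSet (cylSet l) := by
  have : cylSet l = ⋂ i : Fin l.length, (fun ω : Traj Y O rmax => ω i.1) ⁻¹' {l.get i} := by
    ext ω
    simp [cylSet]
  rw [this]
  exact MeasurableSet.iInter fun i => measurable_pi_apply _ (MeasurableSet.of_discrete)

theorem measurable_avg (m : ℕ) : Measurable fun ω : Traj Y O rmax => avg ω m := by
  unfold avg
  refine Measurable.div_const (Finset.measurable_sum _ fun i _ => ?_) _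
  exact (Measurable.of_discrete (f := rew)).comp (measurable_pi_apply i)

theorem measurable_limsup_avg :
    Measurable fun ω : Traj Y O rmax => limsup (avg ω) atTop :=
  Measurable.limsup measurable_avg

theorem avg_nonneg (ω : Traj Y O rmax) (m : ℕ) : 0 ≤ avg ω m :=
  div_nonneg (Finset.sum_nonneg fun _ _ => Nat.cast_nonneg _) (Nat.cast_nonneg _)

theorem avg_le (ω : Traj Y O rmax) (m : ℕ) : avg ω m ≤ rmax := by
  unfold avg
  refine div_le_of_le_mul₀ (Nat.cast_nonneg _) (Nat.cast_nonneg _) ?_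
  calc ∑ i ∈ Finset.range m, rew (ω i) ≤ ∑ _i ∈ Finset.range m, (rmax : ℝ) :=
        Finset.sum_le_sum fun i _ => Nat.cast_le.2 (Nat.lt_succ_iff.1 (ω i).2.1.2)
    _ = rmax * m := by simp [mul_comm]

theorem isBoundedUnder_le_avg (ω : Traj Y O rmax) :
    IsBoundedUnder (· ≤ ·) atTop (avg ω) :=
  isBoundedUnder_of ⟨rmax, avg_le ω⟩

theorem isCoboundedUnder_le_avg (ω : Traj Y O rmax) :
    IsCoboundedUnder (· ≤ ·) atTop (avg ω) :=
  IsBoundedUnder.isCoboundedUnder_le (isBoundedUnder_of ⟨0, avg_nonneg ω⟩)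

theorem avg_congr {ω ω' : Traj Y O rmax} {m : ℕ} (h : ∀ i < m, ω i = ω' i) :
    avg ω m = avg ω' m := by
  unfold avg
  rw [Finset.sum_congr rfl fun i hi => by rw [h i (Finset.mem_range.1 hi)]]

/-- Trajectories whose average reward never exceeds `c` at the times in `(t, N]`. -/
def lowAvg (t N : ℕ) (c : ℝ) : Set (Traj Y O rmax) := {ω | ∀ m, t < m → m ≤ N → avg ω m ≤ c}

theorem measurableSet_lowAvg (t N : ℕ) (c : ℝ) :
    MeasurableSet (lowAvg t N c : Set (Traj Y O rmax)) := by
  simp only [lowAvg, Set.ofPred_forall]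
  exact MeasurableSet.iInter fun m => MeasurableSet.iInter fun _ => MeasurableSet.iInter fun _ =>
    measurableSet_le (measurable_avg m) measurable_const

theorem limsup_avg_le_of_mem_lowAvg {t : ℕ} {c : ℝ} {ω : Traj Y O rmax}
    (h : ∀ N, ω ∈ lowAvg t N c) : limsup (avg ω) atTop ≤ c := by
  refine limsup_le_of_le (isCoboundedUnder_le_avg ω) ?_
  filter_upwards [eventually_gt_atTop t] with m hm
  exact h m m hm le_rfl

/-- The policy which, during the phase `[T j, T (j + 1))`, follows `Q j h`, where `h` is the
history at the beginning of the phase. -/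
def phasePolicy (T : ℕ → ℕ) (Q : ℕ → List (Cycle Y O rmax) → Policy Y O rmax) :
    Policy Y O rmax := fun l =>
  let j := Nat.findGreatest (fun j => T j ≤ l.length) l.length
  Q j (l.take (T j)) l

theorem phasePolicy_eq {T : ℕ → ℕ} (hT : StrictMono T)
    (Q : ℕ → List (Cycle Y O rmax) → Policy Y O rmax) {j : ℕ} {h l : List (Cycle Y O rmax)}
    (hh : h.length = T j) (hl : h <+: l) (hlen : l.length < T (j + 1)) :
    phasePolicy T Q l = Q j h l := by
  have hj : Nat.findGreatest (fun j => T j ≤ l.length) l.length = j := by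
    rw [Nat.findGreatest_eq_iff]
    have hle : T j ≤ l.length := hh ▸ hl.length_le
    refine ⟨(hT.id_le j).trans hle, fun _ => hle, fun n hn _ => ?_⟩
    exact not_le.2 (hlen.trans_le (hT.monotone hn))
  simp only [phasePolicy, hj]
  rw [← hh, ← List.prefix_iff_eq_take.1 hl]

end Trajectories

variable {Y O : Type} [Fintype Y] [Fintype O] {rmax : ℕ}

/-- A measure of a union of fibres of `trajPrefix N` is determined by the cylinder measures. -/
theorem measure_eq_of_cylSet_eq {μ μ' : Measure (Traj Y O rmax)} {h : List (Cycle Y O rmax)}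
    {N : ℕ} (hN : h.length ≤ N)
    (hμ : ∀ l, h <+: l → l.length = N → μ (cylSet l) = μ' (cylSet l))
    {S : Set (Traj Y O rmax)} (hS : S ⊆ cylSet h)
    (hdet : ∀ ω ω', (∀ i < N, ω i = ω' i) → ω ∈ S → ω' ∈ S) : μ S = μ' S := by
  have hfin : (trajPrefix N '' S).Finite := by
    refine (List.finite_length_eq (Cycle Y O rmax) N).subset ?_
    rintro _ ⟨ω, -, rfl⟩
    exact length_trajPrefix N ω
  have hfib : ∀ l ∈ hfin.toFinset, trajPrefix N ⁻¹' {l} = cylSet l ∧ h <+: l ∧ l.length = N := by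
    intro l hl
    obtain ⟨ω, hω, rfl⟩ := hfin.mem_toFinset.1 hl
    refine ⟨?_, isPrefix_trajPrefix (hS hω) hN, length_trajPrefix N ω⟩
    conv_rhs => rw [← trajPrefix_preimage_singleton, length_trajPrefix]
  have hSeq : S = trajPrefix N ⁻¹' (hfin.toFinset : Set (List (Cycle Y O rmax))) := by
    ext ω
    simp only [Set.Finite.coe_toFinset, Set.mem_preimage, Set.mem_image]
    refine ⟨fun hω => ⟨ω, hω, rfl⟩, ?_⟩
    rintro ⟨ω', hω', heq⟩
    refine hdet ω' ω (fun i hi => ?_) hω'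
    have := congrArg (fun l' : List (Cycle Y O rmax) => l'[i]?) heq
    simpa [trajPrefix, hi] using this
  have hmeas : ∀ l ∈ hfin.toFinset, MeasurableSet (trajPrefix N ⁻¹' {l}) := fun l hl => by
    rw [(hfib l hl).1]
    exact measurableSet_cylSet l
  rw [hSeq, ← sum_measure_preimage_singleton _ hmeas, ← sum_measure_preimage_singleton _ hmeas]
  refine Finset.sum_congr rfl fun l hl => ?_
  rw [(hfib l hl).1, hμ l (hfib l hl).2.1 (hfib l hl).2.2]

theorem measure_eq_sum_cylSet (μ : Measure (Traj Y O rmax)) (n : ℕ) (S : Set (Traj Y O rmax)) :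
    μ S = ∑ l ∈ (List.finite_length_eq (Cycle Y O rmax) n).toFinset, μ (cylSet l ∩ S) := by
  have hfib : ∀ l ∈ (List.finite_length_eq (Cycle Y O rmax) n).toFinset,
      trajPrefix n ⁻¹' {l} = cylSet l := fun l hl => by
    have : l.length = n := by simpa using hl
    rw [← this, trajPrefix_preimage_singleton]
  have key := sum_measure_preimage_singleton (μ := μ.restrict S)
    (List.finite_length_eq (Cycle Y O rmax) n).toFinset (f := trajPrefix n) fun l hl => by
      rw [hfib l hl]
      exact measurableSet_cylSet l
  have huniv : trajPrefix n ⁻¹'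
      ((List.finite_length_eq (Cycle Y O rmax) n).toFinset : Set (List (Cycle Y O rmax)))
        = Set.univ := by
    ext ω
    simp [length_trajPrefix]
  rw [huniv, Measure.restrict_apply_univ] at key
  rw [← key]
  refine Finset.sum_congr rfl fun l hl => ?_
  rw [hfib l hl, Measure.restrict_apply (measurableSet_cylSet l)]

namespace Environment

variable (ν : Environment Y O rmax)

theorem action_eq_and_cond_pos {p : Policy Y O rmax} {h : List (Cycle Y O rmax)}
    (hp : ν.P p (cylSet h) ≠ 0) (i : ℕ) (hi : i < h.length) :
    (h[i]).1 = p (h.take i) ∧ 0 < ν.cond (h.take i) (h[i]).1 (h[i]).2 := by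
  have hne : ν.P p (cylSet (h.take i ++ [h[i]])) ≠ 0 := by
    refine fun h0 => hp (measure_mono_null (cylSet_anti ?_) h0)
    rw [List.take_concat_get' h i hi]
    exact ⟨_, List.take_append_drop _ _⟩
  rw [ν.P_cyl] at hne
  have := right_ne_zero_of_mul hne
  split_ifs at this with hact
  · exact ⟨hact, by simpa using this⟩
  · simp at this

theorem histProbX_pos {p : Policy Y O rmax} {h : List (Cycle Y O rmax)}
    (hp : ν.P p (cylSet h) ≠ 0) : 0 < histProbX ν h :=
  Finset.prod_pos fun i _ => (ν.action_eq_and_cond_pos hp i.1 i.2).2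

theorem P_replacePolicy_cylSet {p : Policy Y O rmax} {h : List (Cycle Y O rmax)}
    (hp : ν.P p (cylSet h) ≠ 0) (q : Policy Y O rmax) :
    ν.P (replacePolicy h q) (cylSet h) = ν.P p (cylSet h) := by
  suffices H : ∀ i ≤ h.length,
      ν.P (replacePolicy h q) (cylSet (h.take i)) = ν.P p (cylSet (h.take i)) by
    simpa using H h.length le_rfl
  intro i
  induction i with
  | zero =>
    have := ν.P_prob p
    have := ν.P_prob (replacePolicy h q)
    simp [cylSet_nil]
  | succ i ih =>
    intro hi
    have hact := (ν.action_eq_and_cond_pos hp i hi).1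
    have hact' : (h[i]).1 = replacePolicy h q (h.take i) := by
      have hlen : (h.take i).length = i := by simp; omega
      simp only [replacePolicy, hlen]
      rw [dif_pos (by omega)]
      rfl
    rw [← List.take_concat_get' h i hi, ν.P_cyl, ν.P_cyl, ih (by omega), if_pos hact,
      if_pos hact']

theorem P_cylSet_append_congr {p p' : Policy Y O rmax} {h : List (Cycle Y O rmax)} {N : ℕ}
    (hh : ν.P p (cylSet h) = ν.P p' (cylSet h))
    (hpp : ∀ l, h <+: l → l.length < N → p l = p' l) (r : List (Cycle Y O rmax))
    (hr : (h ++ r).length ≤ N) : ν.P p (cylSet (h ++ r)) = ν.P p' (cylSet (h ++ r)) := by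
  induction r using List.reverseRecOn with
  | nil => simpa using hh
  | append_singleton r z ih =>
    have hlt : (h ++ r).length < N := by
      simp only [List.length_append, List.length_singleton] at hr ⊢
      omega
    rw [← List.append_assoc, ν.P_cyl, ν.P_cyl, ih hlt.le, hpp _ (List.prefix_append h r) hlt]

/-- A policy which follows `q` between the end of the history `h` and time `N` has the same
low-average probability within `h` as the policy recovering from `h` with `q`. -/
theorem P_lowAvg_le {p q : Policy Y O rmax} {h : List (Cycle Y O rmax)} {N : ℕ} {c : ℝ}
    {ε : ℝ≥0∞} (hN : h.length ≤ N) (hpq : ∀ l, h <+: l → l.length < N → p l = q l)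
    (hε : 0 < histProbX ν h → condProb ν q h (lowAvg h.length N c) ≤ ε) :
    ν.P p (cylSet h ∩ lowAvg h.length N c) ≤ ε * ν.P p (cylSet h) := by
  by_cases hp : ν.P p (cylSet h) = 0
  · rw [measure_mono_null Set.inter_subset_left hp]
    exact zero_le
  have := ν.P_prob (replacePolicy h q)
  have heq := ν.P_replacePolicy_cylSet hp q
  have hS : ν.P p (cylSet h ∩ lowAvg h.length N c)
      = ν.P (replacePolicy h q) (cylSet h ∩ lowAvg h.length N c) := by
    refine measure_eq_of_cylSet_eq hN ?_ Set.inter_subset_left ?_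
    · rintro _ ⟨r, rfl⟩ hr
      refine ν.P_cylSet_append_congr heq.symm (fun l hl hlN => ?_) r hr.le
      rw [hpq l hl hlN, replacePolicy, dif_neg (not_lt.2 hl.length_le)]
    · rintro ω ω' hω ⟨h₁, h₂⟩
      refine ⟨fun i => ?_, fun m hm hmN => ?_⟩
      · rw [← hω i (i.2.trans_le hN), h₁ i]
      · rw [← avg_congr fun i hi => hω i (hi.trans_le hmN)]
        exact h₂ m hm hmN
  rw [hS, ← heq, ← ProbabilityTheory.cond_mul_eq_inter (measurableSet_cylSet h)]
  exact mul_le_mul_left (hε (ν.histProbX_pos hp)) _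

end Environment

theorem tendsto_condProb_lowAvg {ν : Environment Y O rmax} {q : Policy Y O rmax}
    {h : List (Cycle Y O rmax)} {V c : ℝ} (hc : c < V)
    (hq : condProb ν q h {ω | limsup (avg ω) atTop = V} = 1) (t : ℕ) :
    Tendsto (fun N => condProb ν q h (lowAvg t N c)) atTop (nhds 0) := by
  have := ν.P_prob (replacePolicy h q)
  have hpos : ν.P (replacePolicy h q) (cylSet h) ≠ 0 := by
    intro h0
    rw [condProb, condMeasure, ProbabilityTheory.cond_eq_zero_of_meas_eq_zero h0] at hq
    simp at hq
  have : IsProbabilityMeasure (condMeasure ν q h) :=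
    ProbabilityTheory.cond_isProbabilityMeasure hpos
  have hanti : Antitone fun N => (lowAvg t N c : Set (Traj Y O rmax)) :=
    fun N M hNM ω hω m hm hmN => hω m hm (hmN.trans hNM)
  have hlim := tendsto_measure_iInter_atTop (μ := condMeasure ν q h)
    (fun N => (measurableSet_lowAvg t N c).nullMeasurableSet) hanti ⟨0, measure_ne_top _ _⟩
  have hnull : condMeasure ν q h (⋂ N, lowAvg t N c) = 0 := by
    have hae : ∀ᵐ ω ∂condMeasure ν q h, limsup (avg ω) atTop = V :=
      (mem_ae_iff_prob_eq_one (measurable_limsup_avg (measurableSet_singleton V))).2 hq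
    refine measure_mono_null ?_ (ae_iff.1 hae)
    intro ω hω
    exact ((limsup_avg_le_of_mem_lowAvg (Set.mem_iInter.1 hω)).trans_lt hc).ne
  rwa [hnull] at hlim

theorem exists_horizon {ν : Environment Y O rmax} {V : ℝ}
    {q : List (Cycle Y O rmax) → Policy Y O rmax}
    (hq : ∀ h, 0 < histProbX ν h → condProb ν (q h) h {ω | limsup (avg ω) atTop = V} = 1)
    {ε : ℝ} (hε : 0 < ε) (t : ℕ) :
    ∃ N, t < N ∧ ∀ h : List (Cycle Y O rmax), h.length = t → 0 < histProbX ν h →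
      condProb ν (q h) h (lowAvg t N (V - ε)) ≤ ENNReal.ofReal ε := by
  have hev : ∀ᶠ N in atTop, ∀ h ∈ {h : List (Cycle Y O rmax) | h.length = t},
      0 < histProbX ν h → condProb ν (q h) h (lowAvg t N (V - ε)) ≤ ENNReal.ofReal ε := by
    rw [eventually_all_finite (List.finite_length_eq _ t)]
    intro h _
    by_cases hh : 0 < histProbX ν h
    · filter_upwards [(tendsto_condProb_lowAvg (sub_lt_self V hε) (hq h hh) t).eventually_le_const
        (ENNReal.ofReal_pos.2 hε)] with N hN _ using hN
    · exact Eventually.of_forall fun _ h' => absurd h' hh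
  obtain ⟨N, hN, htN⟩ := (hev.and (eventually_gt_atTop t)).exists
  exact ⟨N, htN, hN⟩

theorem IsUpperOptimalValue.unique {ν : Environment Y O rmax} {V V' : ℝ}
    (h : IsUpperOptimalValue ν V) (h' : IsUpperOptimalValue ν V') : V = V' := by
  have key : ∀ {V V' : ℝ}, IsUpperOptimalValue ν V → IsUpperOptimalValue ν V' → V ≤ V' := by
    rintro V V' ⟨p, hp, -⟩ ⟨-, -, hle⟩
    have := ν.P_prob p
    have h₁ : ∀ᵐ ω ∂ν.P p, limsup (avg ω) atTop = V :=
      (mem_ae_iff_prob_eq_one (measurable_limsup_avg (measurableSet_singleton V))).2 hp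
    have h₂ : ∀ᵐ ω ∂ν.P p, limsup (avg ω) atTop ≤ V' :=
      (mem_ae_iff_prob_eq_one (measurable_limsup_avg measurableSet_Iic)).2 (hle p)
    obtain ⟨ω, h₁, h₂⟩ := (h₁.and h₂).exists
    exact h₁ ▸ h₂
  exact le_antisymm (key h h') (key h' h)

/-- If the low-average probabilities of the phases `(t k, N k]` tend to zero, a policy attains
the upper optimal value. -/
theorem IsUpperOptimalValue.upperValueIs {ν : Environment Y O rmax} {V : ℝ}
    (hV : IsUpperOptimalValue ν V) {p : Policy Y O rmax} {t N : ℕ → ℕ} {ε : ℕ → ℝ}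
    (ht : ∀ k, k ≤ t k) (hε : Tendsto ε atTop (nhds 0))
    (hlow : ∀ k, ν.P p (lowAvg (t k) (N k) (V - ε k)) ≤ ENNReal.ofReal (ε k)) :
    UpperValueIs ν p V := by
  have := ν.P_prob p
  have hle : ∀ᵐ ω ∂ν.P p, limsup (avg ω) atTop ≤ V :=
    (mem_ae_iff_prob_eq_one (measurable_limsup_avg measurableSet_Iic)).2 (hV.choose_spec.2 p)
  have hfreq : ∀ᵐ ω ∂ν.P p, ∀ K, ∃ k ≥ K, ω ∉ lowAvg (t k) (N k) (V - ε k) := by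
    rw [ae_all_iff]
    intro K
    rw [ae_iff]
    have hlim : Tendsto (fun k => ENNReal.ofReal (ε k)) atTop (nhds 0) := by
      simpa using ENNReal.tendsto_ofReal hε
    refine le_antisymm (ge_of_tendsto hlim ?_) (zero_le)
    filter_upwards [eventually_ge_atTop K] with k hk
    refine (measure_mono fun ω hω => ?_).trans (hlow k)
    by_contra hcon
    exact hω ⟨k, hk, hcon⟩
  have hae : ∀ᵐ ω ∂ν.P p, limsup (avg ω) atTop = V := by
    filter_upwards [hle, hfreq] with ω h₁ h₂
    refine le_antisymm h₁ (le_of_forall_pos_sub_le fun δ hδ => ?_)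
    refine le_limsup_of_frequently_le ?_ (isBoundedUnder_le_avg ω)
    rw [frequently_atTop]
    intro M
    obtain ⟨K, hK⟩ := eventually_atTop.1 (hε.eventually_lt_const hδ)
    obtain ⟨k, hk, hω⟩ := h₂ (max K M)
    simp only [lowAvg, Set.mem_ofPred_eq, not_forall, not_le] at hω
    obtain ⟨m, hm, -, hlt⟩ := hω
    refine ⟨m, ?_, ?_⟩
    · exact ((le_max_right K M).trans hk).trans ((ht k).trans hm.le)
    · have := hK k ((le_max_left K M).trans hk)
      linarith
  exact (mem_ae_iff_prob_eq_one (measurable_limsup_avg (measurableSet_singleton V))).1 hae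

/-- **Theorem 2 (recoverable ⇒ upper self-optimizing).**
For any countable class `C` of recoverable environments, there exists a policy which is
upper self-optimizing for `C`: it attains `V̄(ν,p) = V̄*_ν` with probability 1 for every
`ν ∈ C`. -/
theorem recoverable_upperSelfOptimizing {Y O : Type} [Fintype Y] [Fintype O]
    [Nonempty Y] [Nonempty O] {rmax : ℕ}
    (C : Set (Environment Y O rmax)) (hcount : C.Countable)
    (hrec : ∀ ν ∈ C, Recoverable ν) :
    ∃ p : Policy Y O rmax, UpperSelfOptimizing p C := by
  rcases C.eq_empty_or_nonempty with rfl | hne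
  · exact ⟨fun _ => Classical.arbitrary Y, fun ν hν => absurd hν (Set.notMem_empty ν)⟩
  obtain ⟨e, rfl⟩ := hcount.exists_eq_range hne
  have hrec' : ∀ i, ∃ V, IsUpperOptimalValue (e i) V ∧
      ∃ q : List (Cycle Y O rmax) → Policy Y O rmax, ∀ h, 0 < histProbX (e i) h →
        condProb (e i) (q h) h {ω | limsup (avg ω) atTop = V} = 1 := by
    intro i
    obtain ⟨V, hV, hq⟩ := hrec (e i) ⟨i, rfl⟩
    refine ⟨V, hV, ?_⟩
    choose! q hq using hq
    exact ⟨q, hq⟩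
  choose V hV Q hQ using hrec'
  have hpos : ∀ j : ℕ, (0 : ℝ) < 1 / ((j : ℝ) + 1) := fun j => Nat.one_div_pos_of_nat
  choose N hN hlow using fun j t => exists_horizon (hQ j.unpair.1) (hpos j) t
  let T : ℕ → ℕ := fun n => Nat.rec 0 N n
  have hT : StrictMono T := strictMono_nat_of_lt_succ fun j => hN j (T j)
  refine ⟨phasePolicy T fun j => Q j.unpair.1, ?_⟩
  rintro _ ⟨i, rfl⟩ V' hV'
  rw [hV'.unique (hV i)]
  refine (hV i).upperValueIs (t := fun k => T (Nat.pair i k)) (N := fun k => T (Nat.pair i k + 1))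
    (ε := fun k => 1 / ((Nat.pair i k : ℕ) + 1 : ℝ))
    (fun k => (Nat.right_le_pair i k).trans (hT.id_le _)) ?_ fun k => ?_
  · exact tendsto_one_div_add_atTop_nhds_zero_nat.comp
      (tendsto_atTop_mono (Nat.right_le_pair i) tendsto_id)
  have hprob := (e i).P_prob (phasePolicy T fun j => Q j.unpair.1)
  generalize hj : Nat.pair i k = j
  have hji : j.unpair.1 = i := by simp [← hj]
  rw [measure_eq_sum_cylSet _ (T j)]
  have hbound : ∀ h ∈ (List.finite_length_eq (Cycle Y O rmax) (T j)).toFinset,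
      (e i).P (phasePolicy T fun j => Q j.unpair.1)
        (cylSet h ∩ lowAvg (T j) (T (j + 1)) (V i - 1 / (j + 1)))
      ≤ ENNReal.ofReal (1 / (j + 1)) *
        (e i).P (phasePolicy T fun j => Q j.unpair.1) (cylSet h ∩ Set.univ) := by
    intro h hh
    have hh : h.length = T j := by simpa using hh
    rw [← hh, Set.inter_univ]
    refine (e i).P_lowAvg_le (q := Q i h) (hh ▸ (hT j.lt_succ_self).le)
      (fun l hl hlen => ?_) fun hhp => ?_
    · rw [phasePolicy_eq hT _ hh hl hlen, hji]
    · have := hlow j (T j) h hh (by rwa [hji])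
      rw [hji] at this
      rw [hh]
      exact this
  refine (Finset.sum_le_sum hbound).trans ?_
  rw [← Finset.mul_sum, ← measure_eq_sum_cylSet, measure_univ, mul_one]

end RL
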